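/- Let m be an odd positive integer such that q = 2m² − 1 is a prime power. Let X₁, X₂, X₃, X₄ be subsets of F_{q²} partitioning F_{q²}∖{0}, let τ ∈ {1, −1}, set Yᵢ := ω^{−τm²}·{x^q : x ∈ Xᵢ} for i = 1,2,3,4, and write G := G_q(η). Assume conditions (1)–(4): (1) X₁ = ω^{2m²}·X₃ and X₂ = ω^{2m²}·X₄; (2) each Xᵢ is a union of cosets of the subgroup ⟨ω^{4m²}⟩ of F_{q²}^×; (3) |X₁| = |X₃| = m(m²−1)(m−1) and |X₂| = |X₄| = m(m²−1)(m+1); (4) for every a ∈ F_{q²}∖{0}: if a ∈ Y₁ then (ψ'(aX₁), ψ'(aX₂), ψ'(aX₃), ψ'(aX₄)) = ((m²+m−1)/2 − (m/2)G, −(m²+m)/2 − ((m+1)/2)G, (m²+m−1)/2 + (m/2)G, −(m²+m)/2 + ((m+1)/2)G); if a ∈ Y₂ then it equals ((−m²+m)/2 − ((m−1)/2)G, (m²−m−1)/2 + (m/2)G, (−m²+m)/2 + ((m−1)/2)G, (m²−m−1)/2 − (m/2)G); if a ∈ Y₃ then it equals ((m²+m−1)/2 + (m/2)G, −(m²+m)/2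 + ((m+1)/2)G, (m²+m−1)/2 − (m/2)G, −(m²+m)/2 − ((m+1)/2)G); and if a ∈ Y₄ then it equals ((−m²+m)/2 + ((m−1)/2)G, (m²−m−1)/2 − (m/2)G, (−m²+m)/2 − ((m−1)/2)G, (m²−m−1)/2 + (m/2)G). Let ℓ be an integer with ω^ℓ ∈ X₂∪X₄ and ω^{ℓq} − ω^ℓ ∈ ω^{τm²}·⟨ω^{4m²}⟩. Set (S₀, S₁) := (X₁∪X₄, X₁∪X₂) if ω^ℓ ∈ X₂ and (S₀, S₁) := (X₂∪X₃, X₃∪X₄) if ω^ℓ ∈ X₄, and for d = 0, 1 define D_d := {x ∈ F_q : 1 + x·ω^ℓ ∈ S_d}. Then |D₀| = m² − m, |D₁| = m², { |D₀ ∩ ((C_0^{(2,q)}∪{0}) + s)| + |D₁ ∩ (C_0^{(2,q)} + s)| : s ∈ F_q } = {m²−m, m²}, and { |D₀ ∩ (C_0^{(2,q)} + s)| + |D₁ ∩ ((F_q∖(C_0^{(2,q)}∪{0})) + s)| : s ∈ F_q } = {m²−m, m²}. -/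

import Mathlib

noncomputable section

open Complex

open scoped Classical

open Classical in
/-- The quadratic character of a finite field, with values in `ℂ`. -/
noncomputable def quadChar (F : Type*) [Field F] : F → ℂ :=
  fun x => if x = 0 then 0 else if IsSquare x then 1 else -1
lemma quadChar_eq (F : Type) [Field F] [Fintype F] (x : F) :
    quadChar F x = ((quadraticChar F x : ℤ) : ℂ) := by
  unfold quadChar
  by_cases h : x = 0
  · simp [h]
  · by_cases hs : IsSquare x
    · simp [h, hs, (quadraticChar_one_iff_isSquare h).2 hs]
    · simp [h, hs, quadraticChar_neg_one_iff_not_isSquare.2 hs]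

lemma gauss_sq (F : Type) [Field F] [Fintype F] (h2 : ringChar F ≠ 2) (hm1 : IsSquare (-1 : F))
    (ψ : AddChar F ℂ) (hψ : ψ ≠ 1) :
    (∑ x : F, quadChar F x * ψ x) ^ 2 = (Fintype.card F : ℂ) := by
  have hp := AddChar.IsPrimitive.of_ne_one hψ
  have h := gaussSum_sq (χ := (quadraticChar F).ringHomComp (Int.castRingHom ℂ)) (ψ := ψ)
    (by
      rw [MulChar.ringHomComp_ne_one_iff]
      · exact quadraticChar_ne_one h2
      · exact Int.cast_injective)
    ((quadraticChar_isQuadratic F).comp _) hp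
  have e : (∑ x : F, quadChar F x * ψ x) =
      gaussSum ((quadraticChar F).ringHomComp (Int.castRingHom ℂ)) ψ := by
    unfold gaussSum
    exact Finset.sum_congr rfl fun x _ => by rw [quadChar_eq]; rfl
  rw [e, h]
  have : quadraticChar F (-1) = 1 := (quadraticChar_one_iff_isSquare (by simp)).2 hm1
  simp [MulChar.ringHomComp_apply, this]

lemma gauss_neg (F : Type) [Field F] [Fintype F] (hm1 : IsSquare (-1 : F))
    (ψ : AddChar F ℂ) (c : F) (hc : c = 1 ∨ c = -1) :
    (∑ x : F, quadChar F x * ψ (-(x * c))) = ∑ x : F, quadChar F x * ψ x := by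
  rcases hc with rfl | rfl
  · rw [← Equiv.sum_comp (Equiv.neg F)]
    refine Finset.sum_congr rfl fun x _ => ?_
    have : quadraticChar F (-1) = 1 := (quadraticChar_one_iff_isSquare (by simp)).2 hm1
    have h2 : quadraticChar F (-x) = quadraticChar F x := by
      rw [← neg_one_mul x, map_mul, this, one_mul]
    simp [quadChar_eq, h2]
  · simp

lemma line_count {F F2 : Type} [Field F] [Fintype F] [Field F2] [Fintype F2] [Algebra F F2]
    (q : ℕ) (hF : Fintype.card F = q) (h2 : ringChar F ≠ 2) (hm1 : IsSquare (-1 : F))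
    (ψ : AddChar F ℂ) (hψ : ψ ≠ 1) (σ : F2 →ₐ[F] F2) (hσσ : ∀ x, σ (σ x) = x)
    (tr : F2 → F) (htr : ∀ x : F2, algebraMap F F2 (tr x) = x + σ x)
    (G : ℂ) (hG : G = ∑ x : F, quadChar F x * ψ x)
    (δ z p : F2) (hδ : σ δ = -δ) (hδ0 : δ ≠ 0) (hz : z ≠ 0) (c : F) (hc : c = 1 ∨ c = -1)
    (hpc : tr (σ z / δ * p) = c) (X X' : Finset F2)
    (hsq : ∀ t : F, t ≠ 0 → IsSquare t → ∀ x ∈ X, algebraMap F F2 t * x ∈ X)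
    (hns : ∀ t : F, ¬ IsSquare t → ∀ x ∈ X, algebraMap F F2 t * x ∈ X')
    (hns' : ∀ t : F, ¬ IsSquare t → ∀ x ∈ X', algebraMap F F2 t * x ∈ X)
    (a b : ℤ) (hX : ∑ y ∈ X, ψ (tr (σ z / δ * y)) = (a + b * G) / 2)
    (hX' : ∑ y ∈ X', ψ (tr (σ z / δ * y)) = (a - b * G) / 2) :
    2 * (q : ℤ) * (∑ v : F, if p + algebraMap F F2 v * z ∈ X then 1 else 0) =
      2 * X.card - a + b * q := by
  have inj : Function.Injective (algebraMap F F2) := (algebraMap F F2).injective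
  have tr_add : ∀ x y, tr (x + y) = tr x + tr y := fun x y => inj (by
    rw [map_add, htr, htr, htr, map_add]; ring)
  have tr_smul : ∀ t x, tr (algebraMap F F2 t * x) = t * tr x := fun t x => inj (by
    rw [map_mul, htr, htr, map_mul, AlgHom.commutes]; ring)
  have two : (2 : F) ≠ 0 := Ring.two_ne_zero h2
  have two' : (2 : F2) ≠ 0 := by
    intro h; apply two; apply inj; rw [map_ofNat, map_zero]; exact h
  have trz : tr (σ z / δ * z) = 0 := inj (by
    rw [htr, map_mul, map_div₀, hσσ, hδ, map_zero]; field_simp; ring)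
  have hline : ∀ y, tr (σ z / δ * y) = c ↔ ∃ v : F, p + algebraMap F F2 v * z = y := by
    intro y
    constructor
    · intro hy
      have h0 : tr (σ z / δ * (y - p)) = 0 := by
        have := tr_add (σ z / δ * (y - p)) (σ z / δ * p)
        rw [← mul_add, sub_add_cancel, hy, hpc] at this
        simpa using this
      have h1 := congrArg (algebraMap F F2) h0
      rw [htr, map_mul, map_div₀, hσσ, hδ, map_zero] at h1
      have hsz : σ z ≠ 0 := by
        intro h; apply hz; rw [← hσσ z, h, map_zero]
      have h3 : σ ((y - p) / z) = (y - p) / z := by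
        rw [map_div₀]
        field_simp at h1 ⊢
        linear_combination -h1
      refine ⟨tr ((y - p) / z) / 2, ?_⟩
      have : algebraMap F F2 (tr ((y - p) / z) / 2) = (y - p) / z := by
        rw [map_div₀, htr, h3, map_ofNat]; field_simp; norm_num
      rw [this]; field_simp; ring
    · rintro ⟨v, rfl⟩
      rw [mul_add, tr_add, hpc, mul_left_comm, tr_smul, trz]; ring
  have hcount : (∑ v : F, if p + algebraMap F F2 v * z ∈ X then (1 : ℂ) else 0) =
      ∑ y ∈ X, if tr (σ z / δ * y) - c = 0 then 1 else 0 := by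
    rw [← Finset.sum_filter, ← Finset.sum_filter, Finset.sum_const, Finset.sum_const]
    congr 1
    apply Finset.card_bij (fun v _ => p + algebraMap F F2 v * z)
    · intro v hv
      simp only [Finset.mem_filter, Finset.mem_univ, true_and] at hv ⊢
      exact ⟨hv, sub_eq_zero.2 ((hline _).2 ⟨v, rfl⟩)⟩
    · intro v _ v' _ h
      exact inj (mul_right_cancel₀ hz (add_left_cancel h))
    · intro y hy
      simp only [Finset.mem_filter] at hy
      obtain ⟨v, hv⟩ := (hline y).1 (sub_eq_zero.1 hy.2)
      exact ⟨v, by simp [hv, hy.1], hv⟩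
  have hp := AddChar.IsPrimitive.of_ne_one hψ
  set T : F → ℂ := fun t => ∑ y ∈ X, ψ (t * tr (σ z / δ * y)) with hT
  have hTv : ∀ t, T t = (a + b * (quadChar F t) * G) / 2 + if t = 0 then (X.card - a / 2 : ℂ) else 0 := by
    intro t
    by_cases ht : t = 0
    · subst ht
      simp [hT, quadChar]
    have hat : algebraMap F F2 t ≠ 0 := by simpa using ht
    have hat' : algebraMap F F2 t⁻¹ ≠ 0 := by simpa using ht
    by_cases hs : IsSquare t
    · have : quadChar F t = 1 := by simp [quadChar, ht, hs]
      rw [this, if_neg ht, mul_one, add_zero, ← hX]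
      refine Finset.sum_bij (fun y _ => algebraMap F F2 t * y) (fun y hy => hsq t ht hs y hy)
        (fun _ _ _ _ h => mul_left_cancel₀ hat h) (fun y hy => ?_) (fun y _ => ?_)
      · refine ⟨algebraMap F F2 t⁻¹ * y, hsq _ (inv_ne_zero ht) (by simpa using hs) y hy, ?_⟩
        rw [← mul_assoc, ← map_mul, mul_inv_cancel₀ ht]; simp
      · rw [mul_left_comm, tr_smul]
    · have : quadChar F t = -1 := by simp [quadChar, ht, hs]
      have e : ((a : ℂ) + b * (-1) * G) / 2 = (a - b * G) / 2 := by ring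
      rw [this, if_neg ht, add_zero, e, ← hX']
      refine Finset.sum_bij (fun y _ => algebraMap F F2 t * y) (fun y hy => hns t hs y hy)
        (fun _ _ _ _ h => mul_left_cancel₀ hat h) (fun y hy => ?_) (fun y _ => ?_)
      · refine ⟨algebraMap F F2 t⁻¹ * y, hns' _ (by simpa using hs) y hy, ?_⟩
        rw [← mul_assoc, ← map_mul, mul_inv_cancel₀ ht]; simp
      · rw [mul_left_comm, tr_smul]
  have hc0 : c ≠ 0 := by rcases hc with rfl | rfl <;> simp
  have hψ0 : ∑ t : F, ψ (-(t * c)) = 0 := by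
    have := AddChar.sum_mulShift (-c) hp
    simpa [hc0] using this
  have hsum : (q : ℂ) * (∑ y ∈ X, if tr (σ z / δ * y) - c = 0 then 1 else 0) =
      ∑ t : F, ψ (-(t * c)) * T t := by
    rw [Finset.mul_sum]
    have : ∀ y ∈ X, (q : ℂ) * (if tr (σ z / δ * y) - c = 0 then 1 else 0) =
        ∑ t : F, ψ (-(t * c)) * ψ (t * tr (σ z / δ * y)) := by
      intro y _
      have h := AddChar.sum_mulShift (tr (σ z / δ * y) - c) hp
      rw [mul_ite, mul_one, mul_zero, ← hF]
      simp only [Nat.cast_ite, Nat.cast_zero] at h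
      rw [← h]
      refine Finset.sum_congr rfl fun t _ => ?_
      rw [← AddChar.map_add_eq_mul]; congr 1; ring
    rw [Finset.sum_congr rfl this, Finset.sum_comm]
    simp only [hT, Finset.mul_sum]
  have hfin : ∑ t : F, ψ (-(t * c)) * T t = X.card - a / 2 + b / 2 * q := by
    have e : ∀ t, ψ (-(t * c)) * T t = (a / 2) * ψ (-(t * c)) +
        (b / 2 * G) * (quadChar F t * ψ (-(t * c))) +
        if t = 0 then (X.card - a / 2 : ℂ) else 0 := by
      intro t
      rw [hTv]
      by_cases ht : t = 0
      · simp [ht, quadChar]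
      · simp only [if_neg ht]; ring
    simp only [e]
    rw [Finset.sum_add_distrib, Finset.sum_add_distrib, ← Finset.mul_sum, ← Finset.mul_sum, hψ0,
      gauss_neg F hm1 ψ c hc, ← hG, Finset.sum_ite_eq' Finset.univ (0 : F)]
    have := gauss_sq F h2 hm1 ψ hψ
    rw [← hG, hF] at this
    simp only [Finset.mem_univ, if_true]
    linear_combination (b / 2 : ℂ) * this
  have : ((2 * (q : ℤ) * (∑ v : F, if p + algebraMap F F2 v * z ∈ X then 1 else 0) : ℤ) : ℂ) =
      ((2 * X.card - a + b * q : ℤ) : ℂ) := by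
    push_cast
    rw [hcount, mul_assoc, hsum, hfin]; ring
  exact_mod_cast this

lemma flip_sum {F F2 : Type} [Field F] [Fintype F] [Field F2] [Algebra F F2]
    (h : F2 → ℤ)
    (hh : ∀ t : F, t ≠ 0 → ∀ y, h (algebraMap F F2 t * y) = quadraticChar F t * h y)
    (w : F2) (s : F) :
    ∑ x : F, h (1 + algebraMap F F2 x * w) * quadraticChar F (x - s) =
      (∑ v : F, h (w + algebraMap F F2 v * (1 + algebraMap F F2 s * w))) - h w := by
  rw [← Equiv.sum_comp (Equiv.addRight s), ← Equiv.sum_comp (inv_involutive.toPerm (fun x : F => x⁻¹))]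
  have : h w = ∑ v : F, if v = 0 then h w else 0 := by simp
  rw [this, ← Finset.sum_sub_distrib]
  refine Finset.sum_congr rfl fun v _ => ?_
  by_cases hv : v = 0
  · simp [hv]
  · have hav : algebraMap F F2 v ≠ 0 := by simpa using hv
    have e : w + algebraMap F F2 v * (1 + algebraMap F F2 s * w) =
        algebraMap F F2 v * (1 + algebraMap F F2 (v⁻¹ + s) * w) := by
      rw [map_add, map_inv₀]; field_simp; ring
    rw [e, hh v hv]
    have e2 : quadraticChar F v⁻¹ = quadraticChar F v := by
      have h1 : quadraticChar F v⁻¹ * quadraticChar F v = 1 := by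
        rw [← map_mul, inv_mul_cancel₀ hv, map_one]
      rcases quadraticChar_dichotomy hv with h2 | h2 <;> rw [h2] at h1 ⊢ <;> lia
    simp [hv, e2, mul_comm]

lemma ncard_sum {F : Type} [Fintype F] (S : Set F) [DecidablePred (fun x => x ∈ S)] :
    (S.ncard : ℤ) = ∑ x : F, if x ∈ S then 1 else 0 := by
  rw [Set.ncard_eq_toFinset_card', Finset.sum_boole]
  congr 2
  ext; simp

lemma ind_C {F : Type} [Field F] [Fintype F] (x s : F) :
    2 * (if x ∈ ((fun x => x + s) '' {x : F | x ≠ 0 ∧ IsSquare x}) then (1 : ℤ) else 0) =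
      1 + quadraticChar F (x - s) - (if x = s then 1 else 0) := by
  have : x ∈ ((fun x => x + s) '' {x : F | x ≠ 0 ∧ IsSquare x}) ↔ (x - s ≠ 0 ∧ IsSquare (x - s)) := by
    simp only [Set.image_add_right, Set.mem_preimage, Set.mem_ofPred_eq, sub_eq_add_neg]
  by_cases h : x = s
  · subst h; simp [this]
  · have h' : x - s ≠ 0 := sub_ne_zero.2 h
    by_cases hs : IsSquare (x - s)
    · rw [if_pos (this.2 ⟨h', hs⟩), if_neg h, (quadraticChar_one_iff_isSquare h').2 hs]; norm_num
    · rw [if_neg (fun H => hs (this.1 H).2), if_neg h, quadraticChar_neg_one_iff_not_isSquare.2 hs]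
      norm_num

lemma ind_C0 {F : Type} [Field F] [Fintype F] (x s : F) :
    2 * (if x ∈ ((fun x => x + s) '' ({x : F | x ≠ 0 ∧ IsSquare x} ∪ {0})) then (1 : ℤ) else 0) =
      1 + quadraticChar F (x - s) + (if x = s then 1 else 0) := by
  have h1 := ind_C x s
  have : x ∈ ((fun x => x + s) '' ({x : F | x ≠ 0 ∧ IsSquare x} ∪ {0})) ↔
      (x ∈ ((fun x => x + s) '' {x : F | x ≠ 0 ∧ IsSquare x}) ∨ x = s) := by
    rw [Set.image_union]; simp; tauto
  by_cases h : x = s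
  · subst h; simp
  · simp only [this, h, or_false, if_false] at h1 ⊢
    lia

lemma ind_N {F : Type} [Field F] [Fintype F] (x s : F) :
    2 * (if x ∈ ((fun x => x + s) '' (Set.univ \ ({x : F | x ≠ 0 ∧ IsSquare x} ∪ {0})))
      then (1 : ℤ) else 0) =
      1 - quadraticChar F (x - s) - (if x = s then 1 else 0) := by
  have h1 := ind_C0 x s
  have : x ∈ ((fun x => x + s) '' (Set.univ \ ({x : F | x ≠ 0 ∧ IsSquare x} ∪ {0}))) ↔
      ¬ (x ∈ ((fun x => x + s) '' ({x : F | x ≠ 0 ∧ IsSquare x} ∪ {0}))) := by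
    simp only [Set.image_add_right, Set.mem_preimage, Set.mem_sdiff, Set.mem_univ, true_and]
  simp only [this]
  split_ifs at h1 ⊢ <;> simp_all <;> lia

lemma range_two {F : Type} [Fintype F] (f : F → ℕ) (A B : ℕ)
    (h : ∀ s, f s = A ∨ f s = B) (hA : ∃ s, f s = A) (hB : ∃ s, f s = B) :
    Set.range f = ({A, B} : Set ℕ) := by
  ext n
  constructor
  · rintro ⟨s, rfl⟩; exact h s
  · rintro (rfl | rfl)
    · exact hA
    · exact hB

def Vl {F F2 : Type} [Field F] [Field F2] (ψ : AddChar F ℂ) (tr : F2 → F) (G : ℂ)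
    (c : F2) (X X' : Finset F2) (a b : ℤ) : Prop :=
  ∑ y ∈ X, ψ (tr (c * y)) = (a + b * G) / 2 ∧ ∑ y ∈ X', ψ (tr (c * y)) = (a - b * G) / 2

lemma Vl.swap {F F2 : Type} [Field F] [Field F2] {ψ : AddChar F ℂ} {tr : F2 → F} {G : ℂ}
    {c : F2} {X X' : Finset F2} {a b : ℤ} (h : Vl ψ tr G c X X' a b) :
    Vl ψ tr G c X' X a (-b) := by
  obtain ⟨h1, h2⟩ := h
  refine ⟨?_, ?_⟩
  · rw [h2]; push_cast; ring
  · rw [h1]; push_cast; ring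

lemma equivar {F F2 : Type} [Field F] [Fintype F] [Field F2] [Algebra F F2]
    (X X' : Finset F2)
    (hsq : ∀ t : F, t ≠ 0 → IsSquare t → ∀ x ∈ X, algebraMap F F2 t * x ∈ X)
    (hsq' : ∀ t : F, t ≠ 0 → IsSquare t → ∀ x ∈ X', algebraMap F F2 t * x ∈ X')
    (hns : ∀ t : F, ¬ IsSquare t → ∀ x ∈ X, algebraMap F F2 t * x ∈ X')
    (hns' : ∀ t : F, ¬ IsSquare t → ∀ x ∈ X', algebraMap F F2 t * x ∈ X)
    (t : F) (ht : t ≠ 0) (y : F2) :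
    ((if algebraMap F F2 t * y ∈ X then (1 : ℤ) else 0) -
      (if algebraMap F F2 t * y ∈ X' then 1 else 0)) =
    quadraticChar F t * ((if y ∈ X then 1 else 0) - (if y ∈ X' then 1 else 0)) := by
  have e : y = algebraMap F F2 t⁻¹ * (algebraMap F F2 t * y) := by
    rw [← mul_assoc, ← map_mul, inv_mul_cancel₀ ht]; simp
  by_cases hs : IsSquare t
  · have hs' : IsSquare t⁻¹ := by simpa using hs
    rw [(quadraticChar_one_iff_isSquare ht).2 hs]
    have h1 : algebraMap F F2 t * y ∈ X ↔ y ∈ X :=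
      ⟨fun h => by rw [e]; exact hsq _ (inv_ne_zero ht) hs' _ h, hsq t ht hs y⟩
    have h2 : algebraMap F F2 t * y ∈ X' ↔ y ∈ X' :=
      ⟨fun h => by rw [e]; exact hsq' _ (inv_ne_zero ht) hs' _ h, hsq' t ht hs y⟩
    simp only [h1, h2, one_mul]
  · have hs' : ¬ IsSquare t⁻¹ := by simpa using hs
    rw [quadraticChar_neg_one_iff_not_isSquare.2 hs]
    have h1 : algebraMap F F2 t * y ∈ X ↔ y ∈ X' :=
      ⟨fun h => by rw [e]; exact hns _ hs' _ h, hns' t hs y⟩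
    have h2 : algebraMap F F2 t * y ∈ X' ↔ y ∈ X :=
      ⟨fun h => by rw [e]; exact hns' _ hs' _ h, hns t hs y⟩
    simp only [h1, h2]; ring

set_option maxHeartbeats 2000000 in
lemma core {F F2 : Type} [Field F] [Fintype F] [Field F2] [Fintype F2] [Algebra F F2]
    (m q : ℕ) (hm : 2 ≤ m) (hq : (q : ℤ) = 2 * m ^ 2 - 1)
    (hF : Fintype.card F = q) (h2 : ringChar F ≠ 2) (hm1 : IsSquare (-1 : F))
    (ψ : AddChar F ℂ) (hψ : ψ ≠ 1) (σ : F2 →ₐ[F] F2) (hσσ : ∀ x, σ (σ x) = x)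
    (tr : F2 → F) (htr : ∀ x : F2, algebraMap F F2 (tr x) = x + σ x)
    (G : ℂ) (hG : G = ∑ x : F, quadChar F x * ψ x)
    (X₁ X₂ X₃ X₄ : Finset F2)
    (hd12 : Disjoint X₁ X₂) (hd13 : Disjoint X₁ X₃) (hd14 : Disjoint X₁ X₄)
    (hd23 : Disjoint X₂ X₃) (hd24 : Disjoint X₂ X₄) (hd34 : Disjoint X₃ X₄)
    (hcov : ∀ y : F2, y ≠ 0 → y ∈ X₁ ∨ y ∈ X₂ ∨ y ∈ X₃ ∨ y ∈ X₄)
    (hs1 : ∀ t : F, t ≠ 0 → IsSquare t → ∀ x ∈ X₁, algebraMap F F2 t * x ∈ X₁)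
    (hs2 : ∀ t : F, t ≠ 0 → IsSquare t → ∀ x ∈ X₂, algebraMap F F2 t * x ∈ X₂)
    (hs3 : ∀ t : F, t ≠ 0 → IsSquare t → ∀ x ∈ X₃, algebraMap F F2 t * x ∈ X₃)
    (hs4 : ∀ t : F, t ≠ 0 → IsSquare t → ∀ x ∈ X₄, algebraMap F F2 t * x ∈ X₄)
    (hn13 : ∀ t : F, ¬ IsSquare t → ∀ x ∈ X₁, algebraMap F F2 t * x ∈ X₃)
    (hn31 : ∀ t : F, ¬ IsSquare t → ∀ x ∈ X₃, algebraMap F F2 t * x ∈ X₁)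
    (hn24 : ∀ t : F, ¬ IsSquare t → ∀ x ∈ X₂, algebraMap F F2 t * x ∈ X₄)
    (hn42 : ∀ t : F, ¬ IsSquare t → ∀ x ∈ X₄, algebraMap F F2 t * x ∈ X₂)
    (hc1 : (X₁.card : ℤ) = m * (m ^ 2 - 1) * (m - 1))
    (hc2 : (X₂.card : ℤ) = m * (m ^ 2 - 1) * (m + 1))
    (hc3 : (X₃.card : ℤ) = m * (m ^ 2 - 1) * (m - 1))
    (hc4 : (X₄.card : ℤ) = m * (m ^ 2 - 1) * (m + 1))
    (w : F2) (hw : w ∈ X₂) (hδ0 : σ w - w ≠ 0)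
    (V1 : ∀ z ∈ X₁, Vl ψ tr G (σ z / (σ w - w)) X₁ X₃ (m ^ 2 + m - 1) (-m) ∧
      Vl ψ tr G (σ z / (σ w - w)) X₂ X₄ (-(m ^ 2 + m)) (-(m + 1)))
    (V2 : ∀ z ∈ X₂, Vl ψ tr G (σ z / (σ w - w)) X₁ X₃ (-m ^ 2 + m) (-(m - 1)) ∧
      Vl ψ tr G (σ z / (σ w - w)) X₂ X₄ (m ^ 2 - m - 1) m)
    (V3 : ∀ z ∈ X₃, Vl ψ tr G (σ z / (σ w - w)) X₁ X₃ (m ^ 2 + m - 1) m ∧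
      Vl ψ tr G (σ z / (σ w - w)) X₂ X₄ (-(m ^ 2 + m)) (m + 1))
    (V4 : ∀ z ∈ X₄, Vl ψ tr G (σ z / (σ w - w)) X₁ X₃ (-m ^ 2 + m) (m - 1) ∧
      Vl ψ tr G (σ z / (σ w - w)) X₂ X₄ (m ^ 2 - m - 1) (-m))
    (C₀ : Set F) (hC₀ : C₀ = {x : F | x ≠ 0 ∧ IsSquare x})
    (D₀ D₁ : Set F)
    (hD₀ : D₀ = {x : F | (1 + algebraMap F F2 x * w) ∈ X₁ ∪ X₄})
    (hD₁ : D₁ = {x : F | (1 + algebraMap F F2 x * w) ∈ X₁ ∪ X₂}) :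
    D₀.ncard = m ^ 2 - m ∧ D₁.ncard = m ^ 2 ∧
      (Set.range fun s : F =>
          (D₀ ∩ ((fun x => x + s) '' (C₀ ∪ {0}))).ncard +
            (D₁ ∩ ((fun x => x + s) '' C₀)).ncard) =
        ({m ^ 2 - m, m ^ 2} : Set ℕ) ∧
      (Set.range fun s : F =>
          (D₀ ∩ ((fun x => x + s) '' C₀)).ncard +
            (D₁ ∩ ((fun x => x + s) '' (Set.univ \ (C₀ ∪ {0})))).ncard) =
        ({m ^ 2 - m, m ^ 2} : Set ℕ) := by
  have inj : Function.Injective (algebraMap F F2) := (algebraMap F F2).injective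
  have hδ : σ (σ w - w) = -(σ w - w) := by rw [map_sub, hσσ]; ring
  have hw0 : w ≠ 0 := by
    rintro rfl; simp at hδ0
  have hmZ : (2 : ℤ) ≤ m := by exact_mod_cast hm
  have hq0 : (q : ℤ) ≠ 0 := by rw [hq]; nlinarith
  have dis : ∀ y, ¬ (y ∈ X₁ ∧ y ∈ X₂) ∧ ¬ (y ∈ X₁ ∧ y ∈ X₃) ∧ ¬ (y ∈ X₁ ∧ y ∈ X₄) ∧
      ¬ (y ∈ X₂ ∧ y ∈ X₃) ∧ ¬ (y ∈ X₂ ∧ y ∈ X₄) ∧ ¬ (y ∈ X₃ ∧ y ∈ X₄) := fun y =>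
    ⟨fun h => Finset.disjoint_left.1 hd12 h.1 h.2, fun h => Finset.disjoint_left.1 hd13 h.1 h.2,
     fun h => Finset.disjoint_left.1 hd14 h.1 h.2, fun h => Finset.disjoint_left.1 hd23 h.1 h.2,
     fun h => Finset.disjoint_left.1 hd24 h.1 h.2, fun h => Finset.disjoint_left.1 hd34 h.1 h.2⟩
  set e1 : F2 → ℤ := fun y => if y ∈ X₁ then 1 else 0 with he1
  set e2 : F2 → ℤ := fun y => if y ∈ X₂ then 1 else 0 with he2
  set e3 : F2 → ℤ := fun y => if y ∈ X₃ then 1 else 0 with he3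
  set e4 : F2 → ℤ := fun y => if y ∈ X₄ then 1 else 0 with he4
  -- points 1 + x w are nonzero
  have hz0 : ∀ x : F, (1 + algebraMap F F2 x * w) ≠ 0 := by
    intro x hx
    have h1 := congrArg σ hx
    rw [map_add, map_mul, AlgHom.commutes, map_one, map_zero] at h1
    have h3 : algebraMap F F2 x * (σ w - w) = 0 := by linear_combination h1 - hx
    rcases mul_eq_zero.1 h3 with h | h
    · rw [h] at hx; simp at hx
    · exact hδ0 h
  have hone : ∀ x : F, e1 (1 + algebraMap F F2 x * w) + e2 (1 + algebraMap F F2 x * w) +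
      e3 (1 + algebraMap F F2 x * w) + e4 (1 + algebraMap F F2 x * w) = 1 := by
    intro x
    have h1 := hcov _ (hz0 x)
    have h3 := dis (1 + algebraMap F F2 x * w)
    simp only [he1, he2, he3, he4]
    rcases h1 with h | h | h | h <;> simp [h] at h3 ⊢ <;> simp [h3]
  have LC13 : ∀ (z p : F2) (c : F), z ≠ 0 → (c = 1 ∨ c = -1) → tr (σ z / (σ w - w) * p) = c →
      ∀ a b : ℤ, Vl ψ tr G (σ z / (σ w - w)) X₁ X₃ a b →
      2 * (q : ℤ) * (∑ v : F, e1 (p + algebraMap F F2 v * z)) = 2 * X₁.card - a + b * q ∧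
      2 * (q : ℤ) * (∑ v : F, e3 (p + algebraMap F F2 v * z)) = 2 * X₃.card - a + (-b) * q := by
    intro z p c hz hc hpc a b hV
    exact ⟨line_count q hF h2 hm1 ψ hψ σ hσσ tr htr G hG _ z p hδ hδ0 hz c hc hpc X₁ X₃
        hs1 hn13 hn31 a b hV.1 hV.2,
      line_count q hF h2 hm1 ψ hψ σ hσσ tr htr G hG _ z p hδ hδ0 hz c hc hpc X₃ X₁
        hs3 hn31 hn13 a (-b) hV.swap.1 hV.swap.2⟩
  have LC24 : ∀ (z p : F2) (c : F), z ≠ 0 → (c = 1 ∨ c = -1) → tr (σ z / (σ w - w) * p) = c →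
      ∀ a b : ℤ, Vl ψ tr G (σ z / (σ w - w)) X₂ X₄ a b →
      2 * (q : ℤ) * (∑ v : F, e2 (p + algebraMap F F2 v * z)) = 2 * X₂.card - a + b * q ∧
      2 * (q : ℤ) * (∑ v : F, e4 (p + algebraMap F F2 v * z)) = 2 * X₄.card - a + (-b) * q := by
    intro z p c hz hc hpc a b hV
    exact ⟨line_count q hF h2 hm1 ψ hψ σ hσσ tr htr G hG _ z p hδ hδ0 hz c hc hpc X₂ X₄
        hs2 hn24 hn42 a b hV.1 hV.2,
      line_count q hF h2 hm1 ψ hψ σ hσσ tr htr G hG _ z p hδ hδ0 hz c hc hpc X₄ X₂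
        hs4 hn42 hn24 a (-b) hV.swap.1 hV.swap.2⟩
  have tr1 : tr (σ w / (σ w - w) * 1) = 1 := inj (by
    rw [htr, map_mul, map_div₀, hσσ, hδ, map_one, map_one]; field_simp; ring)
  have trz : ∀ s : F, tr (σ (1 + algebraMap F F2 s * w) / (σ w - w) * w) = -1 := fun s => inj (by
    rw [htr, map_mul, map_div₀, hσσ, hδ, map_neg, map_one, map_add, map_mul, AlgHom.commutes,
      map_one]
    field_simp; ring)
  obtain ⟨n1, n3⟩ := LC13 w 1 1 hw0 (Or.inl rfl) tr1 _ _ (V2 w hw).1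
  obtain ⟨n2, n4⟩ := LC24 w 1 1 hw0 (Or.inl rfl) tr1 _ _ (V2 w hw).2
  have n1' : 2 * (∑ v : F, e1 (1 + algebraMap F F2 v * w)) = ((m : ℤ) - 1) ^ 2 := by
    apply mul_left_cancel₀ hq0
    rw [hc1] at n1; rw [hq] at n1 ⊢; linear_combination n1
  have n2' : 2 * (∑ v : F, e2 (1 + algebraMap F F2 v * w)) = (m : ℤ) ^ 2 + 2 * m - 1 := by
    apply mul_left_cancel₀ hq0
    rw [hc2] at n2; rw [hq] at n2 ⊢; linear_combination n2
  have n4' : 2 * (∑ v : F, e4 (1 + algebraMap F F2 v * w)) = (m : ℤ) ^ 2 - 1 := by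
    apply mul_left_cancel₀ hq0
    rw [hc4] at n4; rw [hq] at n4 ⊢; linear_combination n4
  -- indicators of D₀, D₁
  have iD0 : ∀ x, (if x ∈ D₀ then (1 : ℤ) else 0) =
      e1 (1 + algebraMap F F2 x * w) + e4 (1 + algebraMap F F2 x * w) := by
    intro x
    have h3 := dis (1 + algebraMap F F2 x * w)
    have hx : x ∈ D₀ ↔ (1 + algebraMap F F2 x * w ∈ X₁ ∨ 1 + algebraMap F F2 x * w ∈ X₄) := by
      rw [hD₀]; simp
    simp only [he1, he4, hx]
    by_cases ha : 1 + algebraMap F F2 x * w ∈ X₁ <;> by_cases hb : 1 + algebraMap F F2 x * w ∈ X₄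
    · exact absurd ⟨ha, hb⟩ h3.2.2.1
    all_goals simp [ha, hb]
  have iD1 : ∀ x, (if x ∈ D₁ then (1 : ℤ) else 0) =
      e1 (1 + algebraMap F F2 x * w) + e2 (1 + algebraMap F F2 x * w) := by
    intro x
    have h3 := dis (1 + algebraMap F F2 x * w)
    have hx : x ∈ D₁ ↔ (1 + algebraMap F F2 x * w ∈ X₁ ∨ 1 + algebraMap F F2 x * w ∈ X₂) := by
      rw [hD₁]; simp
    simp only [he1, he2, hx]
    by_cases ha : 1 + algebraMap F F2 x * w ∈ X₁ <;> by_cases hb : 1 + algebraMap F F2 x * w ∈ X₂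
    · exact absurd ⟨ha, hb⟩ h3.1
    all_goals simp [ha, hb]
  have cD0 : (D₀.ncard : ℤ) = m ^ 2 - m := by
    rw [ncard_sum]; simp only [iD0]; rw [Finset.sum_add_distrib]; linarith
  have cD1 : (D₁.ncard : ℤ) = m ^ 2 := by
    rw [ncard_sum]; simp only [iD1]; rw [Finset.sum_add_distrib]; linarith
  have hmm : m ≤ m ^ 2 := by nlinarith
  have cD0' : D₀.ncard = m ^ 2 - m := by zify [hmm]; exact cD0
  have cD1' : D₁.ncard = m ^ 2 := by exact_mod_cast cD1
  -- flips
  have fh := fun s => flip_sum (fun y => e1 y - e3 y) (equivar X₁ X₃ hs1 hs3 hn13 hn31) w s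
  have fk := fun s => flip_sum (fun y => e2 y - e4 y) (equivar X₂ X₄ hs2 hs4 hn24 hn42) w s
  have ew : e1 w = 0 ∧ e2 w = 1 ∧ e3 w = 0 ∧ e4 w = 0 := by
    have h3 := dis w
    simp [hw] at h3
    simp [he1, he2, he3, he4, hw, h3]
  have ηsum : ∀ s : F, ∑ x : F, quadraticChar F (x - s) = 0 := by
    intro s
    rw [← quadraticChar_sum_zero h2]
    exact Equiv.sum_comp (Equiv.subRight s) (fun x => quadraticChar F x)
  have icap : ∀ (A B : Set F) (x : F), (if x ∈ A ∩ B then (1 : ℤ) else 0) =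
      (if x ∈ A then 1 else 0) * (if x ∈ B then 1 else 0) := by
    intro A B x
    by_cases ha : x ∈ A <;> by_cases hb : x ∈ B <;> simp [ha, hb]
  have f1 : ∀ s : F, 2 * (((D₀ ∩ ((fun x => x + s) '' (C₀ ∪ {0}))).ncard +
            (D₁ ∩ ((fun x => x + s) '' C₀)).ncard : ℕ) : ℤ) = 2 * m ^ 2 - m +
      ((∑ v : F, e1 (w + algebraMap F F2 v * (1 + algebraMap F F2 s * w))) -
       (∑ v : F, e3 (w + algebraMap F F2 v * (1 + algebraMap F F2 s * w)))) -
      (e2 (1 + algebraMap F F2 s * w) - e4 (1 + algebraMap F F2 s * w)) := by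
    intro s
    have h1 := fh s
    rw [Finset.sum_sub_distrib] at h1
    push_cast
    rw [ncard_sum, ncard_sum, ← Finset.sum_add_distrib, Finset.mul_sum]
    have pt : ∀ x : F, 2 * ((if x ∈ D₀ ∩ ((fun x => x + s) '' (C₀ ∪ {0})) then (1 : ℤ) else 0) +
        (if x ∈ D₁ ∩ ((fun x => x + s) '' C₀) then 1 else 0)) =
        (if x ∈ D₀ then 1 else 0) + (if x ∈ D₁ then 1 else 0) + quadraticChar F (x - s) +
        (e1 (1 + algebraMap F F2 x * w) - e3 (1 + algebraMap F F2 x * w)) * quadraticChar F (x - s)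
        + (if x = s then (e4 (1 + algebraMap F F2 x * w) - e2 (1 + algebraMap F F2 x * w)) else 0) := by
      intro x
      rw [icap, icap, hC₀, iD0, iD1]
      have g1 := ind_C0 x s
      have g2 := ind_C x s
      have g3 := hone x
      have g4 : (if x = s then (e4 (1 + algebraMap F F2 x * w) - e2 (1 + algebraMap F F2 x * w)) else 0)
        = (e4 (1 + algebraMap F F2 x * w) - e2 (1 + algebraMap F F2 x * w)) * if x = s then 1 else 0 := by
        rw [mul_ite, mul_one, mul_zero]
      rw [g4]
      linear_combination (e1 (1 + algebraMap F F2 x * w) + e4 (1 + algebraMap F F2 x * w)) * g1 +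
        (e1 (1 + algebraMap F F2 x * w) + e2 (1 + algebraMap F F2 x * w)) * g2 +
        quadraticChar F (x - s) * g3
    rw [Finset.sum_congr rfl fun x _ => pt x]
    simp only [Finset.sum_add_distrib]
    rw [← ncard_sum, ← ncard_sum, cD0, cD1, ηsum, h1, ew.1, ew.2.2.1,
      Finset.sum_ite_eq' Finset.univ s]
    simp only [Finset.mem_univ, if_true]
    ring
  have f2 : ∀ s : F, 2 * (((D₀ ∩ ((fun x => x + s) '' C₀)).ncard +
            (D₁ ∩ ((fun x => x + s) '' (Set.univ \ (C₀ ∪ {0})))).ncard : ℕ) : ℤ) = 2 * m ^ 2 - m -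
      ((∑ v : F, e2 (w + algebraMap F F2 v * (1 + algebraMap F F2 s * w))) -
       (∑ v : F, e4 (w + algebraMap F F2 v * (1 + algebraMap F F2 s * w)))) -
      (e1 (1 + algebraMap F F2 s * w) - e3 (1 + algebraMap F F2 s * w)) := by
    intro s
    have h1 := fk s
    rw [Finset.sum_sub_distrib] at h1
    push_cast
    rw [ncard_sum, ncard_sum, ← Finset.sum_add_distrib, Finset.mul_sum]
    have pt : ∀ x : F, 2 * ((if x ∈ D₀ ∩ ((fun x => x + s) '' C₀) then (1 : ℤ) else 0) +
        (if x ∈ D₁ ∩ ((fun x => x + s) '' (Set.univ \ (C₀ ∪ {0}))) then 1 else 0)) =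
        (if x ∈ D₀ then 1 else 0) + (if x ∈ D₁ then 1 else 0) +
        (-1) * ((e2 (1 + algebraMap F F2 x * w) - e4 (1 + algebraMap F F2 x * w)) *
          quadraticChar F (x - s))
        + (if x = s then (-1 - e1 (1 + algebraMap F F2 x * w) + e3 (1 + algebraMap F F2 x * w)) else 0) := by
      intro x
      rw [icap, icap, hC₀, iD0, iD1]
      have g1 := ind_C x s
      have g2 := ind_N x s
      have g3 := hone x
      have g4 : (if x = s then (-1 - e1 (1 + algebraMap F F2 x * w) + e3 (1 + algebraMap F F2 x * w)) else 0)
        = (-1 - e1 (1 + algebraMap F F2 x * w) + e3 (1 + algebraMap F F2 x * w)) * if x = s then 1 else 0 := by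
        rw [mul_ite, mul_one, mul_zero]
      rw [g4]
      linear_combination (e1 (1 + algebraMap F F2 x * w) + e4 (1 + algebraMap F F2 x * w)) * g1 +
        (e1 (1 + algebraMap F F2 x * w) + e2 (1 + algebraMap F F2 x * w)) * g2 -
        (if x = s then 1 else 0) * g3
    rw [Finset.sum_congr rfl fun x _ => pt x]
    simp only [Finset.sum_add_distrib]
    rw [← Finset.mul_sum, ← ncard_sum, ← ncard_sum, cD0, cD1, h1, ew.2.1, ew.2.2.2,
      Finset.sum_ite_eq' Finset.univ s]
    simp only [Finset.mem_univ, if_true]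
    ring
  -- differences on the lines through w
  have d13 : ∀ s : F, ∀ a b : ℤ,
      Vl ψ tr G (σ (1 + algebraMap F F2 s * w) / (σ w - w)) X₁ X₃ a b →
      (∑ v : F, e1 (w + algebraMap F F2 v * (1 + algebraMap F F2 s * w))) -
       (∑ v : F, e3 (w + algebraMap F F2 v * (1 + algebraMap F F2 s * w))) = b := by
    intro s a b hV
    obtain ⟨h1, h3⟩ := LC13 _ w (-1) (hz0 s) (Or.inr rfl) (trz s) a b hV
    apply mul_left_cancel₀ (mul_ne_zero two_ne_zero hq0)
    rw [hc1] at h1; rw [hc3] at h3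
    linear_combination h1 - h3
  have d24 : ∀ s : F, ∀ a b : ℤ,
      Vl ψ tr G (σ (1 + algebraMap F F2 s * w) / (σ w - w)) X₂ X₄ a b →
      (∑ v : F, e2 (w + algebraMap F F2 v * (1 + algebraMap F F2 s * w))) -
       (∑ v : F, e4 (w + algebraMap F F2 v * (1 + algebraMap F F2 s * w))) = b := by
    intro s a b hV
    obtain ⟨h1, h3⟩ := LC24 _ w (-1) (hz0 s) (Or.inr rfl) (trz s) a b hV
    apply mul_left_cancel₀ (mul_ne_zero two_ne_zero hq0)
    rw [hc2] at h1; rw [hc4] at h3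
    linear_combination h1 - h3
  have key : ∀ s : F,
      (((D₀ ∩ ((fun x => x + s) '' (C₀ ∪ {0}))).ncard +
            (D₁ ∩ ((fun x => x + s) '' C₀)).ncard : ℕ) : ℤ) =
        (if s ∈ D₁ then (m : ℤ) ^ 2 - m else m ^ 2) ∧
      (((D₀ ∩ ((fun x => x + s) '' C₀)).ncard +
            (D₁ ∩ ((fun x => x + s) '' (Set.univ \ (C₀ ∪ {0})))).ncard : ℕ) : ℤ) =
        (if s ∈ D₀ then (m : ℤ) ^ 2 else m ^ 2 - m) := by
    intro s
    have g1 := f1 s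
    have g2 := f2 s
    have h3 := dis (1 + algebraMap F F2 s * w)
    have hx0 : s ∈ D₀ ↔ (1 + algebraMap F F2 s * w ∈ X₁ ∨ 1 + algebraMap F F2 s * w ∈ X₄) := by
      rw [hD₀]; simp
    have hx1 : s ∈ D₁ ↔ (1 + algebraMap F F2 s * w ∈ X₁ ∨ 1 + algebraMap F F2 s * w ∈ X₂) := by
      rw [hD₁]; simp
    generalize (((D₀ ∩ ((fun x => x + s) '' (C₀ ∪ {0}))).ncard +
            (D₁ ∩ ((fun x => x + s) '' C₀)).ncard : ℕ) : ℤ) = P at g1 ⊢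
    generalize (((D₀ ∩ ((fun x => x + s) '' C₀)).ncard +
            (D₁ ∩ ((fun x => x + s) '' (Set.univ \ (C₀ ∪ {0})))).ncard : ℕ) : ℤ) = Q at g2 ⊢
    rcases hcov _ (hz0 s) with h | h | h | h
    · rw [d13 s _ _ (V1 _ h).1] at g1
      rw [d24 s _ _ (V1 _ h).2] at g2
      simp only [h, true_and, not_true, and_true, true_or, or_true] at h3 hx0 hx1
      simp only [he1, he2, he3, he4, h, h3, if_true, if_false] at g1 g2
      simp only [hx0, hx1, h3, if_true, if_false, or_self]
      constructor <;> linarith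
    · rw [d13 s _ _ (V2 _ h).1] at g1
      rw [d24 s _ _ (V2 _ h).2] at g2
      simp only [h, true_and, not_true, and_true, true_or, or_true] at h3 hx0 hx1
      simp only [he1, he2, he3, he4, h, h3, if_true, if_false] at g1 g2
      simp only [hx0, hx1, h3, if_true, if_false, or_self]
      constructor <;> linarith
    · rw [d13 s _ _ (V3 _ h).1] at g1
      rw [d24 s _ _ (V3 _ h).2] at g2
      simp only [h, true_and, not_true, and_true, true_or, or_true] at h3 hx0 hx1
      simp only [he1, he2, he3, he4, h, h3, if_true, if_false] at g1 g2
      simp only [hx0, hx1, h3, if_true, if_false, or_self]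
      constructor <;> linarith
    · rw [d13 s _ _ (V4 _ h).1] at g1
      rw [d24 s _ _ (V4 _ h).2] at g2
      simp only [h, true_and, not_true, and_true, true_or, or_true] at h3 hx0 hx1
      simp only [he1, he2, he3, he4, h, h3, if_true, if_false] at g1 g2
      simp only [hx0, hx1, h3, if_true, if_false, or_self]
      constructor <;> linarith
  have ex_in : ∀ D : Set F, 0 < D.ncard → ∃ s, s ∈ D := fun D h =>
    Set.nonempty_of_ncard_ne_zero h.ne'
  have ex_out : ∀ D : Set F, D.ncard < q → ∃ s, s ∉ D := by
    intro D h
    by_contra! hc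
    have : D = Set.univ := Set.eq_univ_of_forall hc
    rw [this, Set.ncard_univ, Nat.card_eq_fintype_card, hF] at h
    exact lt_irrefl _ h
  have cast_sub : ((m ^ 2 - m : ℕ) : ℤ) = (m : ℤ) ^ 2 - m := by push_cast [hmm]; ring
  have k1 : ∀ s, s ∈ D₁ → ((D₀ ∩ ((fun x => x + s) '' (C₀ ∪ {0}))).ncard +
            (D₁ ∩ ((fun x => x + s) '' C₀)).ncard) = m ^ 2 - m := by
    intro s hs
    have := (key s).1
    rw [if_pos hs, ← cast_sub] at this
    exact_mod_cast this
  have k2 : ∀ s, s ∉ D₁ → ((D₀ ∩ ((fun x => x + s) '' (C₀ ∪ {0}))).ncard +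
            (D₁ ∩ ((fun x => x + s) '' C₀)).ncard) = m ^ 2 := by
    intro s hs
    have := (key s).1
    rw [if_neg hs] at this
    exact_mod_cast this
  have k3 : ∀ s, s ∉ D₀ → ((D₀ ∩ ((fun x => x + s) '' C₀)).ncard +
            (D₁ ∩ ((fun x => x + s) '' (Set.univ \ (C₀ ∪ {0})))).ncard) = m ^ 2 - m := by
    intro s hs
    have := (key s).2
    rw [if_neg hs, ← cast_sub] at this
    exact_mod_cast this
  have k4 : ∀ s, s ∈ D₀ → ((D₀ ∩ ((fun x => x + s) '' C₀)).ncard +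
            (D₁ ∩ ((fun x => x + s) '' (Set.univ \ (C₀ ∪ {0})))).ncard) = m ^ 2 := by
    intro s hs
    have := (key s).2
    rw [if_pos hs] at this
    exact_mod_cast this
  obtain ⟨s1, hs1'⟩ := ex_in D₁ (by zify; rw [cD1]; nlinarith)
  obtain ⟨s2, hs2'⟩ := ex_out D₁ (by zify; rw [cD1, hq]; nlinarith)
  obtain ⟨s3, hs3'⟩ := ex_in D₀ (by zify; rw [cD0]; nlinarith)
  obtain ⟨s4, hs4'⟩ := ex_out D₀ (by zify; rw [cD0, hq]; nlinarith)
  refine ⟨cD0', cD1', ?_, ?_⟩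
  · apply range_two
    · intro s
      by_cases hs : s ∈ D₁
      · exact Or.inl (k1 s hs)
      · exact Or.inr (k2 s hs)
    · exact ⟨s1, k1 s1 hs1'⟩
    · exact ⟨s2, k2 s2 hs2'⟩
  · apply range_two
    · intro s
      by_cases hs : s ∈ D₀
      · exact Or.inr (k4 s hs)
      · exact Or.inl (k3 s hs)
    · exact ⟨s4, k3 s4 hs4'⟩
    · exact ⟨s3, k4 s3 hs3'⟩

set_option maxHeartbeats 1000000 in
/-- the two-intersection sets of Theorem 6.4 of the paper, obtained from a
four-class translation association scheme on `F_{q²}`, `q = 2m² − 1`, `m` odd. -/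
theorem stmt_18 (m q : ℕ) (hm : 0 < m) (hmodd : Odd m)
    (hq : q = 2 * m ^ 2 - 1) (hqpp : IsPrimePow q)
    (F F2 : Type) [Field F] [Fintype F] [Field F2] [Fintype F2] [Algebra F F2]
    (hF : Fintype.card F = q) (hF2 : Fintype.card F2 = q ^ 2)
    (ω : F2ˣ) (hω : ∀ x : F2ˣ, x ∈ Subgroup.zpowers ω)
    (ψ : AddChar F ℂ) (hψ : ∃ a, ψ a ≠ 1)
    (tr : F2 → F) (htr : ∀ x : F2, algebraMap F F2 (tr x) = x + x ^ q)
    (G : ℂ) (hG : G = ∑ x : F, quadChar F x * ψ x)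
    (τ : ℤ) (hτ : τ = 1 ∨ τ = -1)
    (X₁ X₂ X₃ X₄ : Finset F2)
    (hd12 : Disjoint X₁ X₂) (hd13 : Disjoint X₁ X₃) (hd14 : Disjoint X₁ X₄)
    (hd23 : Disjoint X₂ X₃) (hd24 : Disjoint X₂ X₄) (hd34 : Disjoint X₃ X₄)
    (hpart : X₁ ∪ X₂ ∪ X₃ ∪ X₄ = Finset.univ.erase (0 : F2))
    (Y₁ Y₂ Y₃ Y₄ : Finset F2)
    (hY1 : Y₁ = (X₁.image fun x => x ^ q).image
      fun x => ((ω ^ (-(τ * (m : ℤ) ^ 2)) : F2ˣ) : F2) * x)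
    (hY2 : Y₂ = (X₂.image fun x => x ^ q).image
      fun x => ((ω ^ (-(τ * (m : ℤ) ^ 2)) : F2ˣ) : F2) * x)
    (hY3 : Y₃ = (X₃.image fun x => x ^ q).image
      fun x => ((ω ^ (-(τ * (m : ℤ) ^ 2)) : F2ˣ) : F2) * x)
    (hY4 : Y₄ = (X₄.image fun x => x ^ q).image
      fun x => ((ω ^ (-(τ * (m : ℤ) ^ 2)) : F2ˣ) : F2) * x)
    -- condition (1)
    (h1a : X₁ = X₃.image fun x => ((ω ^ (2 * m ^ 2) : F2ˣ) : F2) * x)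
    (h1b : X₂ = X₄.image fun x => ((ω ^ (2 * m ^ 2) : F2ˣ) : F2) * x)
    -- condition (2): each Xᵢ is a union of cosets of ⟨ω^{4m²}⟩
    (h2a : ∀ x ∈ X₁, ∀ k : ℤ, ((ω ^ (4 * (m : ℤ) ^ 2 * k) : F2ˣ) : F2) * x ∈ X₁)
    (h2b : ∀ x ∈ X₂, ∀ k : ℤ, ((ω ^ (4 * (m : ℤ) ^ 2 * k) : F2ˣ) : F2) * x ∈ X₂)
    (h2c : ∀ x ∈ X₃, ∀ k : ℤ, ((ω ^ (4 * (m : ℤ) ^ 2 * k) : F2ˣ) : F2) * x ∈ X₃)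
    (h2d : ∀ x ∈ X₄, ∀ k : ℤ, ((ω ^ (4 * (m : ℤ) ^ 2 * k) : F2ˣ) : F2) * x ∈ X₄)
    -- condition (3): sizes
    (h3a : X₁.card = m * (m ^ 2 - 1) * (m - 1)) (h3b : X₃.card = m * (m ^ 2 - 1) * (m - 1))
    (h3c : X₂.card = m * (m ^ 2 - 1) * (m + 1)) (h3d : X₄.card = m * (m ^ 2 - 1) * (m + 1))
    -- condition (4): the prescribed character values (first eigenmatrix)
    (h4 : ∀ a : F2, a ≠ 0 →
      (a ∈ Y₁ →
        (∑ y ∈ X₁, ψ (tr (a * y))) = ((m : ℂ) ^ 2 + m - 1) / 2 - ((m : ℂ) / 2) * G ∧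
        (∑ y ∈ X₂, ψ (tr (a * y))) = -((m : ℂ) ^ 2 + m) / 2 - (((m : ℂ) + 1) / 2) * G ∧
        (∑ y ∈ X₃, ψ (tr (a * y))) = ((m : ℂ) ^ 2 + m - 1) / 2 + ((m : ℂ) / 2) * G ∧
        (∑ y ∈ X₄, ψ (tr (a * y))) = -((m : ℂ) ^ 2 + m) / 2 + (((m : ℂ) + 1) / 2) * G) ∧
      (a ∈ Y₂ →
        (∑ y ∈ X₁, ψ (tr (a * y))) = (-(m : ℂ) ^ 2 + m) / 2 - (((m : ℂ) - 1) / 2) * G ∧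
        (∑ y ∈ X₂, ψ (tr (a * y))) = ((m : ℂ) ^ 2 - m - 1) / 2 + ((m : ℂ) / 2) * G ∧
        (∑ y ∈ X₃, ψ (tr (a * y))) = (-(m : ℂ) ^ 2 + m) / 2 + (((m : ℂ) - 1) / 2) * G ∧
        (∑ y ∈ X₄, ψ (tr (a * y))) = ((m : ℂ) ^ 2 - m - 1) / 2 - ((m : ℂ) / 2) * G) ∧
      (a ∈ Y₃ →
        (∑ y ∈ X₁, ψ (tr (a * y))) = ((m : ℂ) ^ 2 + m - 1) / 2 + ((m : ℂ) / 2) * G ∧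
        (∑ y ∈ X₂, ψ (tr (a * y))) = -((m : ℂ) ^ 2 + m) / 2 + (((m : ℂ) + 1) / 2) * G ∧
        (∑ y ∈ X₃, ψ (tr (a * y))) = ((m : ℂ) ^ 2 + m - 1) / 2 - ((m : ℂ) / 2) * G ∧
        (∑ y ∈ X₄, ψ (tr (a * y))) = -((m : ℂ) ^ 2 + m) / 2 - (((m : ℂ) + 1) / 2) * G) ∧
      (a ∈ Y₄ →
        (∑ y ∈ X₁, ψ (tr (a * y))) = (-(m : ℂ) ^ 2 + m) / 2 + (((m : ℂ) - 1) / 2) * G ∧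
        (∑ y ∈ X₂, ψ (tr (a * y))) = ((m : ℂ) ^ 2 - m - 1) / 2 - ((m : ℂ) / 2) * G ∧
        (∑ y ∈ X₃, ψ (tr (a * y))) = (-(m : ℂ) ^ 2 + m) / 2 - (((m : ℂ) - 1) / 2) * G ∧
        (∑ y ∈ X₄, ψ (tr (a * y))) = ((m : ℂ) ^ 2 - m - 1) / 2 + ((m : ℂ) / 2) * G)) 
    (ℓ : ℤ) (hℓ1 : ((ω ^ ℓ : F2ˣ) : F2) ∈ X₂ ∪ X₄)
    (hℓ2 : ∃ k : ℤ, ((ω ^ (ℓ * (q : ℤ)) : F2ˣ) : F2) - ((ω ^ ℓ : F2ˣ) : F2) =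
      ((ω ^ (τ * (m : ℤ) ^ 2 + 4 * (m : ℤ) ^ 2 * k) : F2ˣ) : F2))
    (S₀ S₁ : Finset F2)
    (hS1 : ((ω ^ ℓ : F2ˣ) : F2) ∈ X₂ → S₀ = X₁ ∪ X₄ ∧ S₁ = X₁ ∪ X₂)
    (hS2 : ((ω ^ ℓ : F2ˣ) : F2) ∈ X₄ → S₀ = X₂ ∪ X₃ ∧ S₁ = X₃ ∪ X₄)
    (C₀ : Set F) (hC₀ : C₀ = {x : F | x ≠ 0 ∧ IsSquare x})
    (D₀ D₁ : Set F)
    (hD₀ : D₀ = {x : F | (1 + algebraMap F F2 x * ((ω ^ ℓ : F2ˣ) : F2)) ∈ S₀})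
    (hD₁ : D₁ = {x : F | (1 + algebraMap F F2 x * ((ω ^ ℓ : F2ˣ) : F2)) ∈ S₁}) :
    D₀.ncard = m ^ 2 - m ∧ D₁.ncard = m ^ 2 ∧
      (Set.range fun s : F =>
          (D₀ ∩ ((fun x => x + s) '' (C₀ ∪ {0}))).ncard +
            (D₁ ∩ ((fun x => x + s) '' C₀)).ncard) =
        ({m ^ 2 - m, m ^ 2} : Set ℕ) ∧
      (Set.range fun s : F =>
          (D₀ ∩ ((fun x => x + s) '' C₀)).ncard +
            (D₁ ∩ ((fun x => x + s) '' (Set.univ \ (C₀ ∪ {0})))).ncard) =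
        ({m ^ 2 - m, m ^ 2} : Set ℕ) := by
  have hm2 : 2 ≤ m := by
    by_contra hlt
    have : m = 1 := by lia
    subst this
    norm_num at hq
    subst hq
    exact not_isPrimePow_one hqpp
  have hmsq : 4 ≤ m ^ 2 := by nlinarith
  have hqZ : (q : ℤ) = 2 * m ^ 2 - 1 := by
    rw [hq, Nat.cast_sub (by lia)]; push_cast; ring
  have hq4 : q % 4 = 1 := by
    obtain ⟨k, rfl⟩ := hmodd
    have : 2 * (2 * k + 1) ^ 2 = 4 * (2 * k ^ 2 + 2 * k) + 2 := by ring
    lia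
  have h2 : ringChar F ≠ 2 := by
    intro h
    have := FiniteField.even_card_iff_char_two.1 h
    rw [hF] at this; lia
  have hm1 : IsSquare (-1 : F) := by
    rw [FiniteField.isSquare_neg_one_iff, hF]; lia
  have hψ1 : ψ ≠ 1 := by
    rintro rfl
    obtain ⟨a, ha⟩ := hψ
    exact ha (by simp)
  obtain ⟨σ, hσ⟩ : ∃ σ : F2 →ₐ[F] F2, ∀ x, σ x = x ^ q :=
    ⟨FiniteField.frobeniusAlgHom F F2, fun x => by
      rw [FiniteField.coe_frobeniusAlgHom, hF]⟩
  have hσσ : ∀ x, σ (σ x) = x := by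
    intro x
    rw [hσ, hσ, ← pow_mul, ← pow_two, ← hF2, FiniteField.pow_card]
  have htr' : ∀ x : F2, algebraMap F F2 (tr x) = x + σ x := fun x => by rw [htr, hσ]
  have hord : (orderOf ω : ℤ) = 4 * m ^ 2 * (m ^ 2 - 1) := by
    rw [orderOf_eq_card_of_forall_mem_zpowers hω, Nat.card_eq_fintype_card, Fintype.card_units, hF2,
      Nat.cast_sub (Nat.one_le_pow _ _ (by lia))]
    push_cast
    rw [hqZ]; ring
  have hone : ∀ n : ℤ, ω ^ (4 * (m : ℤ) ^ 2 * (m ^ 2 - 1) * n) = 1 := by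
    intro n
    rw [← hord, zpow_mul, zpow_natCast, pow_orderOf_eq_one, one_zpow]
  have hpow : ∀ t : F, t ≠ 0 → ∃ j : ℤ, algebraMap F F2 t = ((ω ^ (2 * (m : ℤ) ^ 2 * j) : F2ˣ) : F2) := by
    intro t ht
    have hat : algebraMap F F2 t ≠ 0 := by simpa using ht
    obtain ⟨j, hj⟩ := Subgroup.mem_zpowers_iff.1 (hω (Units.mk0 _ hat))
    have h1 : (Units.mk0 _ hat) ^ (q - 1) = 1 := by
      ext
      rw [Units.val_pow_eq_pow_val, Units.val_mk0, ← map_pow, ← hF,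
        FiniteField.pow_card_sub_one_eq_one t ht, map_one, Units.val_one]
    rw [← hj, ← zpow_natCast, ← zpow_mul, ← orderOf_dvd_iff_zpow_eq_one, hord,
      Nat.cast_sub (by lia), hqZ] at h1
    obtain ⟨n, hn⟩ := h1
    refine ⟨n, ?_⟩
    have hj2 : j = 2 * (m : ℤ) ^ 2 * n := by
      have h3 : (2 * ((m : ℤ) ^ 2 - 1)) ≠ 0 := by
        have : (4 : ℤ) ≤ m ^ 2 := by exact_mod_cast hmsq
        lia
      apply mul_right_cancel₀ h3
      push_cast at hn
      linear_combination hn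
    rw [← hj2, hj, Units.val_mk0]
  have hpow_sq : ∀ t : F, t ≠ 0 → IsSquare t →
      ∃ j : ℤ, algebraMap F F2 t = ((ω ^ (4 * (m : ℤ) ^ 2 * j) : F2ˣ) : F2) := by
    rintro t ht ⟨r, rfl⟩
    obtain ⟨j, hj⟩ := hpow r (left_ne_zero_of_mul ht)
    refine ⟨j, ?_⟩
    rw [map_mul, hj, ← Units.val_mul, ← zpow_add]
    congr 2; ring
  have hpow_ns : ∀ t : F, ¬ IsSquare t →
      ∃ j : ℤ, algebraMap F F2 t = ((ω ^ (4 * (m : ℤ) ^ 2 * j) : F2ˣ) : F2) *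
        ((ω ^ (2 * m ^ 2) : F2ˣ) : F2) := by
    intro t hns
    have ht : t ≠ 0 := by rintro rfl; exact hns (IsSquare.zero)
    obtain ⟨j, hj⟩ := hpow t ht
    rcases Int.even_or_odd' j with ⟨k, hk | hk⟩
    · exfalso
      apply hns
      rw [FiniteField.isSquare_iff h2 ht]
      apply (algebraMap F F2).injective
      have hq2 : ((Fintype.card F / 2 : ℕ) : ℤ) = m ^ 2 - 1 := by rw [hF]; lia
      rw [map_pow, hj, map_one, ← Units.val_pow_eq_pow_val, ← zpow_natCast, ← zpow_mul, hq2, hk]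
      have e : 2 * (m : ℤ) ^ 2 * (2 * k) * (m ^ 2 - 1) = 4 * (m : ℤ) ^ 2 * (m ^ 2 - 1) * k := by ring
      rw [e, hone, Units.val_one]
    · refine ⟨k, ?_⟩
      rw [hj, ← Units.val_mul, ← zpow_natCast, ← zpow_add, hk]
      congr 2; push_cast; ring
  have hsq : ∀ X : Finset F2,
      (∀ x ∈ X, ∀ k : ℤ, ((ω ^ (4 * (m : ℤ) ^ 2 * k) : F2ˣ) : F2) * x ∈ X) →
      ∀ t : F, t ≠ 0 → IsSquare t → ∀ x ∈ X, algebraMap F F2 t * x ∈ X := by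
    intro X hX t ht hs x hx
    obtain ⟨j, hj⟩ := hpow_sq t ht hs
    rw [hj]; exact hX x hx j
  have hns : ∀ X X' : Finset F2,
      (∀ x ∈ X, ∀ k : ℤ, ((ω ^ (4 * (m : ℤ) ^ 2 * k) : F2ˣ) : F2) * x ∈ X) →
      (∀ x ∈ X', ∀ k : ℤ, ((ω ^ (4 * (m : ℤ) ^ 2 * k) : F2ˣ) : F2) * x ∈ X') →
      (X = X'.image fun x => ((ω ^ (2 * m ^ 2) : F2ˣ) : F2) * x) →
      (∀ t : F, ¬ IsSquare t → ∀ x ∈ X, algebraMap F F2 t * x ∈ X') ∧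
      (∀ t : F, ¬ IsSquare t → ∀ x ∈ X', algebraMap F F2 t * x ∈ X) := by
    intro X X' hX hX' hXX
    constructor
    · intro t ht x hx
      obtain ⟨j, hj⟩ := hpow_ns t ht
      rw [hXX] at hx
      obtain ⟨y, hy, rfl⟩ := Finset.mem_image.1 hx
      have e : algebraMap F F2 t * (((ω ^ (2 * m ^ 2) : F2ˣ) : F2) * y) =
          ((ω ^ (4 * (m : ℤ) ^ 2 * (j + 1)) : F2ˣ) : F2) * y := by
        rw [hj, ← mul_assoc, ← Units.val_mul, ← Units.val_mul, ← zpow_natCast, ← zpow_add,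
          ← zpow_add]
        congr 3; push_cast; ring
      rw [e]; exact hX' y hy _
    · intro t ht x hx
      obtain ⟨j, hj⟩ := hpow_ns t ht
      rw [hj, mul_assoc]
      apply hX
      rw [hXX]
      exact Finset.mem_image.2 ⟨x, hx, rfl⟩
  obtain ⟨hn13, hn31⟩ := hns X₁ X₃ h2a h2c h1a
  obtain ⟨hn24, hn42⟩ := hns X₂ X₄ h2b h2d h1b
  have hcov : ∀ y : F2, y ≠ 0 → y ∈ X₁ ∨ y ∈ X₂ ∨ y ∈ X₃ ∨ y ∈ X₄ := by
    intro y hy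
    have : y ∈ X₁ ∪ X₂ ∪ X₃ ∪ X₄ := by rw [hpart]; simp [hy]
    simpa [or_assoc] using this
  have hnz : ∀ y : F2, (y ∈ X₁ ∨ y ∈ X₂ ∨ y ∈ X₃ ∨ y ∈ X₄) → y ≠ 0 := by
    intro y hy
    have : y ∈ X₁ ∪ X₂ ∪ X₃ ∪ X₄ := by simpa [or_assoc] using hy
    rw [hpart] at this
    exact (Finset.mem_erase.1 this).1
  have c1 : 1 ≤ m ^ 2 := by lia
  have c2 : 1 ≤ m := by lia
  have hc1 : (X₁.card : ℤ) = m * (m ^ 2 - 1) * (m - 1) := by rw [h3a]; push_cast [c1, c2]; ring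
  have hc3 : (X₃.card : ℤ) = m * (m ^ 2 - 1) * (m - 1) := by rw [h3b]; push_cast [c1, c2]; ring
  have hc2 : (X₂.card : ℤ) = m * (m ^ 2 - 1) * (m + 1) := by rw [h3c]; push_cast [c1, c2]; ring
  have hc4 : (X₄.card : ℤ) = m * (m ^ 2 - 1) * (m + 1) := by rw [h3d]; push_cast [c1, c2]; ring
  set w : F2 := ((ω ^ ℓ : F2ˣ) : F2) with hw
  obtain ⟨k, hk⟩ := hℓ2
  have hwq : ((ω ^ (ℓ * (q : ℤ)) : F2ˣ) : F2) = σ w := by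
    rw [hσ, hw, zpow_mul, zpow_natCast, Units.val_pow_eq_pow_val]
  rw [hwq] at hk
  have hδ0 : σ w - w ≠ 0 := by rw [hk]; exact Units.ne_zero _
  have hY : ∀ X : Finset F2,
      (∀ x ∈ X, ∀ k : ℤ, ((ω ^ (4 * (m : ℤ) ^ 2 * k) : F2ˣ) : F2) * x ∈ X) → ∀ z ∈ X,
      σ z / (σ w - w) ∈ (X.image fun x => x ^ q).image
        fun x => ((ω ^ (-(τ * (m : ℤ) ^ 2)) : F2ˣ) : F2) * x := by
    intro X hX z hz
    refine Finset.mem_image.2 ⟨_, Finset.mem_image.2 ⟨_, hX z hz (-k), rfl⟩, ?_⟩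
    have e : ((ω ^ (4 * (m : ℤ) ^ 2 * (-k)) : F2ˣ) : F2) ^ q =
        ((ω ^ (4 * (m : ℤ) ^ 2 * (-k)) : F2ˣ) : F2) := by
      rw [← Units.val_pow_eq_pow_val, ← zpow_natCast, ← zpow_mul, hqZ]
      have e2 : 4 * (m : ℤ) ^ 2 * (-k) * (2 * m ^ 2 - 1) =
        4 * (m : ℤ) ^ 2 * (m ^ 2 - 1) * (-2 * k) + 4 * (m : ℤ) ^ 2 * (-k) := by ring
      rw [e2, zpow_add, hone, one_mul]
    rw [mul_pow, e, ← mul_assoc, ← Units.val_mul, ← zpow_add, eq_div_iff hδ0, hk, hσ,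
      mul_right_comm, ← Units.val_mul, ← zpow_add]
    have e3 : -(τ * (m : ℤ) ^ 2) + 4 * (m : ℤ) ^ 2 * (-k) + (τ * (m : ℤ) ^ 2 + 4 * (m : ℤ) ^ 2 * k) = 0 := by
      ring
    rw [e3, zpow_zero, Units.val_one, one_mul]
  have ha : ∀ z : F2, z ≠ 0 → σ z / (σ w - w) ≠ 0 := by
    intro z hz
    refine div_ne_zero (fun h => hz ?_) hδ0
    rw [← hσσ z, h, map_zero]
  have V1 : ∀ z ∈ X₁, Vl ψ tr G (σ z / (σ w - w)) X₁ X₃ (m ^ 2 + m - 1) (-m) ∧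
      Vl ψ tr G (σ z / (σ w - w)) X₂ X₄ (-(m ^ 2 + m)) (-(m + 1)) := by
    intro z hz
    obtain ⟨v1, v2, v3, v4⟩ := (h4 _ (ha z (hnz z (by simp [hz])))).1 (by
      rw [hY1]; exact hY X₁ h2a z hz)
    refine ⟨⟨?_, ?_⟩, ?_, ?_⟩
    · rw [v1]; push_cast; ring
    · rw [v3]; push_cast; ring
    · rw [v2]; push_cast; ring
    · rw [v4]; push_cast; ring
  have V2 : ∀ z ∈ X₂, Vl ψ tr G (σ z / (σ w - w)) X₁ X₃ (-m ^ 2 + m) (-(m - 1)) ∧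
      Vl ψ tr G (σ z / (σ w - w)) X₂ X₄ (m ^ 2 - m - 1) m := by
    intro z hz
    obtain ⟨v1, v2, v3, v4⟩ := (h4 _ (ha z (hnz z (by simp [hz])))).2.1 (by
      rw [hY2]; exact hY X₂ h2b z hz)
    refine ⟨⟨?_, ?_⟩, ?_, ?_⟩
    · rw [v1]; push_cast; ring
    · rw [v3]; push_cast; ring
    · rw [v2]; push_cast; ring
    · rw [v4]; push_cast; ring
  have V3 : ∀ z ∈ X₃, Vl ψ tr G (σ z / (σ w - w)) X₁ X₃ (m ^ 2 + m - 1) m ∧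
      Vl ψ tr G (σ z / (σ w - w)) X₂ X₄ (-(m ^ 2 + m)) (m + 1) := by
    intro z hz
    obtain ⟨v1, v2, v3, v4⟩ := (h4 _ (ha z (hnz z (by simp [hz])))).2.2.1 (by
      rw [hY3]; exact hY X₃ h2c z hz)
    refine ⟨⟨?_, ?_⟩, ?_, ?_⟩
    · rw [v1]; push_cast; ring
    · rw [v3]; push_cast; ring
    · rw [v2]; push_cast; ring
    · rw [v4]; push_cast; ring
  have V4 : ∀ z ∈ X₄, Vl ψ tr G (σ z / (σ w - w)) X₁ X₃ (-m ^ 2 + m) (m - 1) ∧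
      Vl ψ tr G (σ z / (σ w - w)) X₂ X₄ (m ^ 2 - m - 1) (-m) := by
    intro z hz
    obtain ⟨v1, v2, v3, v4⟩ := (h4 _ (ha z (hnz z (by simp [hz])))).2.2.2 (by
      rw [hY4]; exact hY X₄ h2d z hz)
    refine ⟨⟨?_, ?_⟩, ?_, ?_⟩
    · rw [v1]; push_cast; ring
    · rw [v3]; push_cast; ring
    · rw [v2]; push_cast; ring
    · rw [v4]; push_cast; ring
  rcases Finset.mem_union.1 hℓ1 with hw2 | hw4
  · obtain ⟨hS0, hS1⟩ := hS1 hw2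
    rw [hS0] at hD₀
    rw [hS1] at hD₁
    exact core m q hm2 hqZ hF h2 hm1 ψ hψ1 σ hσσ tr htr' G hG X₁ X₂ X₃ X₄
      hd12 hd13 hd14 hd23 hd24 hd34 hcov (hsq _ h2a) (hsq _ h2b) (hsq _ h2c) (hsq _ h2d)
      hn13 hn31 hn24 hn42 hc1 hc2 hc3 hc4 w hw2 hδ0 V1 V2 V3 V4 C₀ hC₀ D₀ D₁ hD₀ hD₁
  · obtain ⟨hS0, hS1⟩ := hS2 hw4
    rw [hS0, Finset.union_comm] at hD₀
    rw [hS1] at hD₁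
    have hcov' : ∀ y : F2, y ≠ 0 → y ∈ X₃ ∨ y ∈ X₄ ∨ y ∈ X₁ ∨ y ∈ X₂ := by
      intro y hy
      have := hcov y hy
      tauto
    exact core m q hm2 hqZ hF h2 hm1 ψ hψ1 σ hσσ tr htr' G hG X₃ X₄ X₁ X₂
      hd34 hd13.symm hd23.symm hd14.symm hd24.symm hd12 hcov'
      (hsq _ h2c) (hsq _ h2d) (hsq _ h2a) (hsq _ h2b)
      hn31 hn13 hn42 hn24 hc3 hc4 hc1 hc2 w hw4 hδ0
      (fun z hz => ⟨(V3 z hz).1.swap, (V3 z hz).2.swap⟩)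
      (fun z hz => ⟨(V4 z hz).1.swap, by simpa using (V4 z hz).2.swap⟩)
      (fun z hz => ⟨by simpa using (V1 z hz).1.swap, by simpa using (V1 z hz).2.swap⟩)
      (fun z hz => ⟨by simpa using (V2 z hz).1.swap, (V2 z hz).2.swap⟩)
      C₀ hC₀ D₀ D₁ hD₀ hD₁
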